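/- arXiv:2505.11029 — 2 statements merged into one kernel-verified Lean document; each statement's English description precedes it below -/
import Mathlib

section
/- For every real number v > 0, the modified Bessel function I_v is differentiable at every z > 0 with derivative I_v′(z) = I_{v+1}(z) + (v/z) · I_v(z). -/
/-- The modified Bessel function of the first kind of order `v`, defined for real `v`
and `z > 0` by `I_v(z) = ∑_{k=0}^∞ (z/2)^(2k+v) / (k! · Γ(k+v+1))`. -/
noncomputable def besselI (v z : ℝ) : ℝ :=
  ∑' k : ℕ, (z / 2) ^ (2 * (k : ℝ) + v) / ((k.factorial : ℝ) * Real.Gamma ((k : ℝ) + v + 1))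

/-- The `k`-th term of the series defining `besselI v z`. -/
noncomputable def besselITerm (v z : ℝ) (k : ℕ) : ℝ :=
  (z / 2) ^ (2 * (k : ℝ) + v) / ((k.factorial : ℝ) * Real.Gamma ((k : ℝ) + v + 1))

theorem pow_mul_Gamma_le_Gamma_natCast_add {s : ℝ} (hs : 0 < s) (k : ℕ) :
    s ^ k * Real.Gamma s ≤ Real.Gamma (k + s) := by
  induction k with
  | zero => simp
  | succ k ih =>
    have hk : (0 : ℝ) ≤ k := k.cast_nonneg
    have h : ((k + 1 : ℕ) : ℝ) + s = (k + s) + 1 := by push_cast; ring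
    rw [h, Real.Gamma_add_one (by positivity), pow_succ', mul_assoc]
    have hpos := Real.Gamma_pos_of_pos hs
    exact mul_le_mul (by linarith) ih (by positivity) (by positivity)

theorem summable_besselITerm {v z : ℝ} (hv : -1 < v) (hz : 0 < z) :
    Summable (besselITerm v z) := by
  have hv' : 0 < v + 1 := by linarith
  have hΓ := Real.Gamma_pos_of_pos hv'
  refine Summable.of_nonneg_of_le (fun k => ?_) (fun k => ?_)
    ((Real.summable_pow_div_factorial ((z / 2) ^ 2 / (v + 1))).mul_left
      ((z / 2) ^ v / Real.Gamma (v + 1)))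
  · have : 0 < Real.Gamma ((k : ℝ) + v + 1) :=
      Real.Gamma_pos_of_pos (by have : (0 : ℝ) ≤ k := k.cast_nonneg
                                linarith)
    unfold besselITerm
    positivity
  · have hle := pow_mul_Gamma_le_Gamma_natCast_add hv' k
    have hpow : (z / 2) ^ (2 * (k : ℝ) + v) = ((z / 2) ^ 2) ^ k * (z / 2) ^ v := by
      rw [Real.rpow_add (by positivity), ← pow_mul, ← Real.rpow_natCast]
      push_cast
      rfl
    calc besselITerm v z k
        ≤ ((z / 2) ^ 2) ^ k * (z / 2) ^ v /
            ((k.factorial : ℝ) * ((v + 1) ^ k * Real.Gamma (v + 1))) := by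
          rw [besselITerm, hpow, add_assoc (k : ℝ)]
          gcongr
      _ = _ := by
          rw [div_pow ((z / 2) ^ 2)]
          generalize ((z / 2) ^ 2) ^ k = a
          field_simp

theorem hasSum_besselI {v z : ℝ} (hv : -1 < v) (hz : 0 < z) :
    HasSum (besselITerm v z) (besselI v z) :=
  (summable_besselITerm hv hz).hasSum

theorem hasDerivAt_besselITerm (v : ℝ) {z : ℝ} (hz : 0 < z) (k : ℕ) :
    HasDerivAt (fun y => besselITerm v y k) ((2 * k + v) / z * besselITerm v z k) z := by
  have h := (((hasDerivAt_id z).div_const 2).rpow_const (p := 2 * (k : ℝ) + v)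
    (Or.inl (by simpa using hz.ne'))).div_const
      ((k.factorial : ℝ) * Real.Gamma ((k : ℝ) + v + 1))
  refine h.congr_deriv ?_
  simp only [id_eq]
  rw [Real.rpow_sub_one (by positivity), besselITerm]
  field_simp

theorem besselITerm_sub_one {v z : ℝ} (hv : 0 < v) (hz : 0 < z) (k : ℕ) :
    besselITerm (v - 1) z k = 2 * (k + v) / z * besselITerm v z k := by
  have hkv : 0 < (k : ℝ) + v := by positivity
  have hΓ := Real.Gamma_pos_of_pos hkv
  rw [besselITerm, besselITerm, Real.Gamma_add_one hkv.ne', ← add_sub_assoc,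
    Real.rpow_sub_one (by positivity), show (k : ℝ) + (v - 1) + 1 = k + v by ring]
  field_simp

theorem besselITerm_add_one {z : ℝ} (v : ℝ) (hz : 0 < z) (k : ℕ) :
    besselITerm (v + 1) z k = 2 * ((k + 1 : ℕ) : ℝ) / z * besselITerm v z (k + 1) := by
  rw [besselITerm, besselITerm, Nat.factorial_succ,
    show 2 * ((k + 1 : ℕ) : ℝ) + v = 2 * k + (v + 1) + 1 by push_cast; ring,
    Real.rpow_add_one (by positivity),
    show ((k + 1 : ℕ) : ℝ) + v + 1 = k + (v + 1) + 1 by push_cast; ring]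
  push_cast
  field_simp

theorem hasDerivAt_besselI_add (v : ℝ) (hv : 0 < v) (z : ℝ) (hz : 0 < z) :
    HasDerivAt (fun z : ℝ => besselI v z) (besselI (v + 1) z + v / z * besselI v z) z := by
  have hsum : HasSum (fun k : ℕ => (2 * k + v) / z * besselITerm v z k)
      (besselI (v + 1) z + v / z * besselI v z) := by
    have hshift : HasSum (fun k : ℕ => 2 * (k : ℝ) / z * besselITerm v z k)
        (besselI (v + 1) z) := by
      rw [← hasSum_nat_add_iff' 1]
      simpa only [← besselITerm_add_one v hz, Finset.sum_range_one, Nat.cast_zero, mul_zero,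
        zero_div, zero_mul, sub_zero] using hasSum_besselI (v := v + 1) (by linarith) hz
    refine (hshift.add ((hasSum_besselI (by linarith) hz).mul_left (v / z))).congr_fun ?_
    intro k
    ring
  rw [← hsum.tsum_eq]
  have hmem : z ∈ Set.Ioo (z / 2) (2 * z) := ⟨by linarith, by linarith⟩
  refine hasDerivAt_tsum_of_isPreconnected (g := fun k y => besselITerm v y k)
    (g' := fun k y => (2 * k + v) / y * besselITerm v y k)
    ((summable_besselITerm (v := v - 1) (z := 2 * z) (by linarith) (by linarith)).mul_left 4)
    isOpen_Ioo isPreconnected_Ioo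
    (fun k y hy => hasDerivAt_besselITerm v (by linarith [hy.1]) k) (fun k y hy => ?_)
    hmem (summable_besselITerm (by linarith) hz) hmem
  have hy : 0 < y ∧ z / 2 ≤ y ∧ y ≤ 2 * z := ⟨by linarith [hy.1], hy.1.le, hy.2.le⟩
  obtain ⟨hy0, hy1, hy2⟩ := hy
  have hΓ : 0 < Real.Gamma ((k : ℝ) + v + 1) := Real.Gamma_pos_of_pos (by positivity)
  have hterm : besselITerm v y k ≤ besselITerm v (2 * z) k := by
    unfold besselITerm
    gcongr
  have hnonneg : 0 ≤ besselITerm v y k := by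
    unfold besselITerm
    positivity
  rw [Real.norm_of_nonneg (by positivity), besselITerm_sub_one hv (by positivity)]
  calc (2 * k + v) / y * besselITerm v y k
      ≤ (2 * (k + v)) / (z / 2) * besselITerm v (2 * z) k := by
        gcongr
        linarith
    _ = 4 * (2 * (k + v) / (2 * z) * besselITerm v (2 * z) k) := by
        field_simp
        ring
end

section
/- Let d ≥ 2 be an integer and let κ > 0. Then the derivative of κ ↦ ln C_d(κ) at κ differs from F_d′(κ) by strictly less than (1/2)·( h_d(κ) − g_d(κ) ) in absolute value, i.e., | (d/dκ) ln C_d(κ) − F_d′(κ) | < (1/2)·( κ / ((d−1)/2 + √(((d−1)/2)² + κ²)) − κ / ((d−1)/2 + √(((d+1)/2)² + κ²)) ). -/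
/-- The von Mises–Fisher normalizing constant
`C_d(κ) = κ^(d/2−1) / ((2π)^(d/2) · I_{d/2−1}(κ))`. -/
noncomputable def vmfC (d : ℕ) (κ : ℝ) : ℝ :=
  κ ^ ((d : ℝ) / 2 - 1) / ((2 * Real.pi) ^ ((d : ℝ) / 2) * besselI ((d : ℝ) / 2 - 1) κ)

/-- The function `F_d(κ)` approximating the log-normalizer of the vMF distribution. -/
noncomputable def F (d : ℕ) (κ : ℝ) : ℝ :=
  ((d : ℝ) - 1) / 4 * Real.log (((d : ℝ) - 1) / 2 + Real.sqrt ((((d : ℝ) - 1) / 2) ^ 2 + κ ^ 2))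
    - 1 / 2 * Real.sqrt ((((d : ℝ) - 1) / 2) ^ 2 + κ ^ 2)
    + ((d : ℝ) - 1) / 4 * Real.log (((d : ℝ) - 1) / 2 + Real.sqrt ((((d : ℝ) + 1) / 2) ^ 2 + κ ^ 2))
    - 1 / 2 * Real.sqrt ((((d : ℝ) + 1) / 2) ^ 2 + κ ^ 2)

open Filter Topology Set

/-- The entire function with `I_v(z) = (z/2)^v · besselSeries v (z²/4)`. -/
noncomputable def besselSeries (v y : ℝ) : ℝ :=
  ∑' k : ℕ, y ^ k / ((k.factorial : ℝ) * Real.Gamma ((k : ℝ) + v + 1))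

lemma Gamma_le_Gamma_natCast_add {v : ℝ} (hv : 0 ≤ v) (k : ℕ) :
    Real.Gamma (v + 1) ≤ Real.Gamma ((k : ℝ) + v + 1) := by
  induction k with
  | zero => simp
  | succ k ih =>
    have hk : (0 : ℝ) ≤ k := k.cast_nonneg
    have hrec : Real.Gamma (((k + 1 : ℕ) : ℝ) + v + 1)
        = ((k : ℝ) + v + 1) * Real.Gamma ((k : ℝ) + v + 1) := by
      rw [← Real.Gamma_add_one (by positivity)]
      push_cast
      ring_nf
    rw [hrec]
    have hpos : 0 < Real.Gamma (v + 1) := Real.Gamma_pos_of_pos (by positivity)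
    nlinarith [mul_nonneg (add_nonneg hk hv) (hpos.le.trans ih)]

lemma norm_besselSeries_term_le {v : ℝ} (hv : 0 ≤ v) (y : ℝ) (k : ℕ) :
    ‖y ^ k / ((k.factorial : ℝ) * Real.Gamma ((k : ℝ) + v + 1))‖
      ≤ |y| ^ k / (k.factorial : ℝ) * (Real.Gamma (v + 1))⁻¹ := by
  have hpos : 0 < Real.Gamma (v + 1) := Real.Gamma_pos_of_pos (by positivity)
  have hle := Gamma_le_Gamma_natCast_add hv k
  have hpos' := hpos.trans_le hle
  have hfac : (0 : ℝ) < k.factorial := by positivity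
  rw [norm_div, norm_pow, Real.norm_eq_abs, Real.norm_of_nonneg (by positivity),
    ← div_eq_mul_inv, div_div]
  gcongr

lemma summable_besselSeries {v : ℝ} (hv : 0 ≤ v) (y : ℝ) :
    Summable fun k : ℕ => y ^ k / ((k.factorial : ℝ) * Real.Gamma ((k : ℝ) + v + 1)) :=
  Summable.of_norm_bounded ((Real.summable_pow_div_factorial |y|).mul_right _)
    (norm_besselSeries_term_le hv y)

lemma besselSeries_pos {v y : ℝ} (hv : 0 ≤ v) (hy : 0 ≤ y) : 0 < besselSeries v y := by
  have hG (k : ℕ) : 0 < Real.Gamma ((k : ℝ) + v + 1) := Real.Gamma_pos_of_pos (by positivity)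
  refine (summable_besselSeries hv y).tsum_pos (fun k => ?_) 0 ?_
  · have := hG k
    positivity
  · have := hG 0
    simp only [pow_zero]
    positivity

lemma besselSeries_zero (v : ℝ) : besselSeries v 0 = (Real.Gamma (v + 1))⁻¹ := by
  rw [besselSeries, tsum_eq_single 0 fun k hk => by simp [hk]]
  simp

lemma succ_mul_besselSeries_coeff (v y : ℝ) (k : ℕ) :
    ((k + 1 : ℕ) : ℝ) * y ^ k
        / (((k + 1).factorial : ℝ) * Real.Gamma (((k + 1 : ℕ) : ℝ) + v + 1))
      = y ^ k / ((k.factorial : ℝ) * Real.Gamma ((k : ℝ) + (v + 1) + 1)) := by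
  have h : ((k + 1 : ℕ) : ℝ) + v + 1 = (k : ℝ) + (v + 1) + 1 := by push_cast; ring
  rw [h, Nat.factorial_succ, Nat.cast_mul, mul_assoc, mul_div_mul_left _ _ (by positivity)]

lemma hasDerivAt_besselSeries {v : ℝ} (hv : 0 ≤ v) (y : ℝ) :
    HasDerivAt (besselSeries v) (besselSeries (v + 1) y) y := by
  set R : ℝ := |y| + 1
  have hR : 0 ≤ R := by positivity
  let t : ℕ → ℝ → ℝ := fun k x =>
    (k : ℝ) * x ^ (k - 1) / ((k.factorial : ℝ) * Real.Gamma ((k : ℝ) + v + 1))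
  have hshift (x : ℝ) (k : ℕ) : t (k + 1) x
      = x ^ k / ((k.factorial : ℝ) * Real.Gamma ((k : ℝ) + (v + 1) + 1)) := by
    simpa [t] using succ_mul_besselSeries_coeff v x k
  have hsum (x : ℝ) : Summable fun k => t k x := by
    rw [← summable_nat_add_iff 1]
    simpa only [hshift] using summable_besselSeries (by positivity : 0 ≤ v + 1) x
  have hbound (k : ℕ) (x : ℝ) (hx : x ∈ Metric.ball (0 : ℝ) R) : ‖t k x‖ ≤ t k R := by
    have hG : 0 < Real.Gamma ((k : ℝ) + v + 1) := Real.Gamma_pos_of_pos (by positivity)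
    have hxR : |x| ≤ R := by simpa using (mem_ball_zero_iff.1 hx).le
    simp only [t, norm_div, norm_mul, norm_pow, Real.norm_eq_abs, abs_of_pos hG, Nat.abs_cast]
    gcongr
  have hy : y ∈ Metric.ball (0 : ℝ) R := by simp [R]
  have h := hasDerivAt_tsum_of_isPreconnected (hsum R) Metric.isOpen_ball
    (convex_ball (0 : ℝ) R).isPreconnected
    (fun k x _ => ((hasDerivAt_pow k x).div_const
      ((k.factorial : ℝ) * Real.Gamma ((k : ℝ) + v + 1))))
    hbound hy (summable_besselSeries hv y) hy
  have hval : ∑' k, t k y = besselSeries (v + 1) y := by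
    rw [(hsum y).tsum_eq_zero_add]
    simp only [hshift, besselSeries]
    simp [t]
  exact hval ▸ h

lemma besselSeries_recurrence {v : ℝ} (hv : 0 ≤ v) (y : ℝ) :
    besselSeries v y
      = (v + 1) * besselSeries (v + 1) y + y * besselSeries (v + 2) y := by
  let c : ℕ → ℝ := fun k =>
    y ^ k / ((k.factorial : ℝ) * Real.Gamma ((k : ℝ) + (v + 1) + 1))
  have hc : Summable c := summable_besselSeries (by positivity) y
  have hsplit (k : ℕ) : y ^ k / ((k.factorial : ℝ) * Real.Gamma ((k : ℝ) + v + 1))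
      = (v + 1) * c k + k * c k := by
    have hG : 0 < Real.Gamma ((k : ℝ) + v + 1) := Real.Gamma_pos_of_pos (by positivity)
    have hne : (k : ℝ) + v + 1 ≠ 0 := by positivity
    have hrec : Real.Gamma ((k : ℝ) + (v + 1) + 1)
        = ((k : ℝ) + v + 1) * Real.Gamma ((k : ℝ) + v + 1) := by
      rw [← Real.Gamma_add_one hne, ← add_assoc]
    simp only [c, hrec]
    field_simp
    ring
  have hk (k : ℕ) : ((k + 1 : ℕ) : ℝ) * c (k + 1)
      = y * (y ^ k / ((k.factorial : ℝ) * Real.Gamma ((k : ℝ) + (v + 2) + 1))) := by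
    have h := succ_mul_besselSeries_coeff (v + 1) y k
    rw [show v + 1 + 1 = v + 2 by ring] at h
    rw [← h]
    simp only [c]
    ring
  have hsum : Summable fun k : ℕ => (k : ℝ) * c k := by
    rw [← summable_nat_add_iff 1]
    simp only [hk]
    exact (summable_besselSeries (by positivity) y).mul_left y
  have htail : ∑' k : ℕ, (k : ℝ) * c k = y * besselSeries (v + 2) y := by
    rw [hsum.tsum_eq_zero_add]
    simp only [hk, tsum_mul_left, besselSeries]
    simp
  rw [← htail, besselSeries, tsum_congr hsplit, (hc.mul_left _).tsum_add hsum, tsum_mul_left]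
  rfl

lemma besselI_eq_rpow_mul_besselSeries (v : ℝ) {z : ℝ} (hz : 0 < z) :
    besselI v z = (z / 2) ^ v * besselSeries v (z ^ 2 / 4) := by
  rw [besselI, besselSeries, ← tsum_mul_left]
  refine tsum_congr fun k => ?_
  have hpow : (z / 2) ^ (2 * (k : ℝ)) = (z ^ 2 / 4) ^ k := by
    rw [Real.rpow_mul (by positivity), Real.rpow_natCast, Real.rpow_ofNat]
    ring_nf
  rw [Real.rpow_add (by positivity), hpow]
  ring

/-- A continuous function that starts nonnegative and strictly increases wherever it is
nonpositive is positive. -/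
lemma pos_of_hasDerivAt_pos_of_nonpos {f f' : ℝ → ℝ} {b : ℝ} (hb : 0 < b)
    (hf : ContinuousOn f (Icc 0 b)) (h0 : 0 ≤ f 0)
    (hf' : ∀ y, 0 < y → HasDerivAt f (f' y) y)
    (hpos : ∀ y, 0 < y → f y ≤ 0 → 0 < f' y) : 0 < f b := by
  by_contra! hfb
  obtain ⟨m, hm0, hmb, hfm, hmin⟩ : ∃ m, 0 < m ∧ m ≤ b ∧ f m ≤ 0 ∧ ∀ y ∈ Icc 0 b, f m ≤ f y := by
    obtain ⟨m, hm, hmin⟩ := isCompact_Icc.exists_isMinOn (nonempty_Icc.2 hb.le) hf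
    rcases hm.1.eq_or_lt with rfl | hm0
    · exact ⟨b, hb, le_rfl, hfb, fun y hy => (hfb.trans h0).trans (hmin hy)⟩
    · exact ⟨m, hm0, hm.2, (hmin (right_mem_Icc.2 hb.le)).trans hfb, fun y hy => hmin hy⟩
  have hslope := (hasDerivAt_iff_tendsto_slope.1 (hf' m hm0)).mono_left
    (nhdsWithin_mono m fun y (hy : y ∈ Iio m) => ne_of_lt hy)
  refine (hpos m hm0 hfm).not_ge (le_of_tendsto hslope ?_)
  filter_upwards [Ioo_mem_nhdsLT hm0] with y hy
  rw [slope_def_field]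
  exact div_nonpos_of_nonneg_of_nonpos
    (sub_nonneg.2 (hmin y ⟨hy.1.le, hy.2.le.trans hmb⟩)) (sub_nonpos.2 hy.2.le)

/-- With `y = z²/4`, this is `z · I_v(z) / I_{v+1}(z)`. -/
noncomputable def besselQuotient (v y : ℝ) : ℝ :=
  2 * besselSeries v y / besselSeries (v + 1) y

lemma besselQuotient_zero {v : ℝ} (hv : 0 ≤ v) : besselQuotient v 0 = 2 * (v + 1) := by
  have hG : 0 < Real.Gamma (v + 1) := Real.Gamma_pos_of_pos (by positivity)
  have hne : v + 1 ≠ 0 := by positivity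
  rw [besselQuotient, besselSeries_zero, besselSeries_zero, Real.Gamma_add_one hne]
  field_simp

lemma lt_besselQuotient {v y : ℝ} (hv : 0 ≤ v) (hy : 0 < y) :
    2 * (v + 1) < besselQuotient v y := by
  have h1 : 0 < besselSeries (v + 1) y := besselSeries_pos (by positivity) hy.le
  have h2 : 0 < besselSeries (v + 2) y := besselSeries_pos (by positivity) hy.le
  rw [besselQuotient, lt_div_iff₀ h1, besselSeries_recurrence hv]
  nlinarith [mul_pos hy h2]

lemma continuousOn_besselQuotient {v : ℝ} (hv : 0 ≤ v) (b : ℝ) :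
    ContinuousOn (besselQuotient v) (Icc 0 b) := fun y hy =>
  (((hasDerivAt_besselSeries hv y).continuousAt.const_mul 2).div
    (hasDerivAt_besselSeries (by positivity : 0 ≤ v + 1) y).continuousAt
    (besselSeries_pos (by positivity) hy.1).ne').continuousWithinAt

/-- The Riccati equation for `besselQuotient`. -/
lemma hasDerivAt_besselQuotient {v y : ℝ} (hv : 0 ≤ v) (hy : 0 < y) :
    HasDerivAt (besselQuotient v)
      ((2 * y + (v + 1) * besselQuotient v y - besselQuotient v y ^ 2 / 2) / y) y := by
  have h1 : 0 < besselSeries (v + 1) y := besselSeries_pos (by positivity) hy.le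
  have hrec := besselSeries_recurrence hv y
  have hd := ((hasDerivAt_besselSeries hv y).const_mul 2).div
    (hasDerivAt_besselSeries (by positivity : 0 ≤ v + 1) y) h1.ne'
  refine hd.congr_deriv ?_
  have h2 : besselSeries (v + 1 + 1) y
      = (besselSeries v y - (v + 1) * besselSeries (v + 1) y) / y := by
    rw [show v + 1 + 1 = v + 2 by ring]
    field_simp
    linarith
  rw [h2, besselQuotient]
  field_simp
  ring

lemma hasDerivAt_besselQuotient_sub_sq {v y : ℝ} (hv : 0 ≤ v) (hy : 0 < y) (c : ℝ) :
    HasDerivAt (fun y => (besselQuotient v y - (v + 1 / 2)) ^ 2 - c - 4 * y)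
      (2 * (besselQuotient v y - (v + 1 / 2))
        * ((2 * y + (v + 1) * besselQuotient v y - besselQuotient v y ^ 2 / 2) / y) - 4) y := by
  have h := ((((hasDerivAt_besselQuotient hv hy).sub_const (v + 1 / 2)).pow 2).sub_const c).sub
    ((hasDerivAt_id y).const_mul 4)
  exact h.congr_deriv (by norm_num)

lemma continuousOn_besselQuotient_sub_sq {v : ℝ} (hv : 0 ≤ v) (b c : ℝ) :
    ContinuousOn (fun y => (besselQuotient v y - (v + 1 / 2)) ^ 2 - c - 4 * y) (Icc 0 b) := by
  have := continuousOn_besselQuotient hv b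
  fun_prop

lemma lt_besselQuotient_sub_sq {v y : ℝ} (hv : 0 ≤ v) (hy : 0 < y) :
    (v + 1 / 2) ^ 2 + 4 * y < (besselQuotient v y - (v + 1 / 2)) ^ 2 := by
  have h := pos_of_hasDerivAt_pos_of_nonpos hy
    (continuousOn_besselQuotient_sub_sq hv y ((v + 1 / 2) ^ 2)) ?_
    (fun y hy => hasDerivAt_besselQuotient_sub_sq hv hy ((v + 1 / 2) ^ 2)) ?_
  · linarith
  · rw [besselQuotient_zero hv]
    nlinarith
  · intro x hx hle
    have hu := lt_besselQuotient hv hx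
    set u := besselQuotient v x
    have key : 2 * (u - (v + 1 / 2)) * ((2 * x + (v + 1) * u - u ^ 2 / 2) / x) - 4
        = ((v + 1 / 2) * u
          - (u - (v + 3 / 2)) * ((u - (v + 1 / 2)) ^ 2 - (v + 1 / 2) ^ 2 - 4 * x)) / x := by
      field_simp
      ring
    rw [key]
    refine div_pos ?_ hx
    have h1 : 0 < (v + 1 / 2) * u := by
      have : 0 < u := by linarith
      positivity
    have h2 := mul_nonpos_of_nonneg_of_nonpos (by linarith : 0 ≤ u - (v + 3 / 2)) hle
    linarith

lemma besselQuotient_sub_sq_lt {v y : ℝ} (hv : 0 ≤ v) (hy : 0 < y) :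
    (besselQuotient v y - (v + 1 / 2)) ^ 2 < (v + 3 / 2) ^ 2 + 4 * y := by
  have h := pos_of_hasDerivAt_pos_of_nonpos hy
    (continuousOn_besselQuotient_sub_sq hv y ((v + 3 / 2) ^ 2)).neg ?_
    (fun y hy => (hasDerivAt_besselQuotient_sub_sq hv hy ((v + 3 / 2) ^ 2)).neg) ?_
  · simp only [Pi.neg_apply] at h
    linarith
  · simp only [Pi.neg_apply]
    rw [besselQuotient_zero hv]
    nlinarith
  · intro x hx hle
    simp only [Pi.neg_apply] at hle
    have hu := lt_besselQuotient hv hx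
    set u := besselQuotient v x
    have key : -(2 * (u - (v + 1 / 2)) * ((2 * x + (v + 1) * u - u ^ 2 / 2) / x) - 4)
        = ((u - (v + 3 / 2)) * ((u - (v + 1 / 2)) ^ 2 - (v + 3 / 2) ^ 2 - 4 * x)
          + (v + 3 / 2) * (u - 2 * (v + 1))) / x := by
      field_simp
      ring
    rw [key]
    refine div_pos ?_ hx
    have h1 : 0 < (v + 3 / 2) * (u - 2 * (v + 1)) := mul_pos (by positivity) (by linarith)
    have h2 : 0 ≤ (u - (v + 3 / 2)) * ((u - (v + 1 / 2)) ^ 2 - (v + 3 / 2) ^ 2 - 4 * x) :=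
      mul_nonneg (by linarith) (by linarith)
    linarith

lemma log_vmfC_eq {d : ℕ} (hd : 2 ≤ d) {κ : ℝ} (hκ : 0 < κ) :
    Real.log (vmfC d κ)
      = Real.log (2 ^ ((d : ℝ) / 2 - 1) / (2 * Real.pi) ^ ((d : ℝ) / 2))
        - Real.log (besselSeries ((d : ℝ) / 2 - 1) (κ ^ 2 / 4)) := by
  have hd' : (2 : ℝ) ≤ d := by exact_mod_cast hd
  have hS : 0 < besselSeries ((d : ℝ) / 2 - 1) (κ ^ 2 / 4) :=
    besselSeries_pos (by linarith) (by positivity)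
  have hpi := Real.pi_pos
  rw [← Real.log_div (by positivity) hS.ne', vmfC, besselI_eq_rpow_mul_besselSeries _ hκ,
    Real.div_rpow hκ.le zero_le_two]
  congr 1
  field_simp

lemma hasDerivAt_log_vmfC {d : ℕ} (hd : 2 ≤ d) {κ : ℝ} (hκ : 0 < κ) :
    HasDerivAt (fun κ : ℝ => Real.log (vmfC d κ))
      (-(κ / besselQuotient ((d : ℝ) / 2 - 1) (κ ^ 2 / 4))) κ := by
  have hd' : (2 : ℝ) ≤ d := by exact_mod_cast hd
  have hv : 0 ≤ (d : ℝ) / 2 - 1 := by linarith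
  have hS : 0 < besselSeries ((d : ℝ) / 2 - 1) (κ ^ 2 / 4) :=
    besselSeries_pos hv (by positivity)
  have hS1 : 0 < besselSeries ((d : ℝ) / 2 - 1 + 1) (κ ^ 2 / 4) :=
    besselSeries_pos (by positivity) (by positivity)
  have hsq : HasDerivAt (fun κ : ℝ => κ ^ 2 / 4) (κ / 2) κ := by
    refine ((hasDerivAt_pow 2 κ).div_const 4).congr_deriv ?_
    norm_num
    ring
  have hcomp : HasDerivAt (fun κ : ℝ => besselSeries ((d : ℝ) / 2 - 1) (κ ^ 2 / 4))
      (besselSeries ((d : ℝ) / 2 - 1 + 1) (κ ^ 2 / 4) * (κ / 2)) κ :=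
    HasDerivAt.comp (h₂ := besselSeries ((d : ℝ) / 2 - 1)) κ (hasDerivAt_besselSeries hv _) hsq
  have h := ((hcomp.log hS.ne').const_sub
    (Real.log (2 ^ ((d : ℝ) / 2 - 1) / (2 * Real.pi) ^ ((d : ℝ) / 2)))).congr_of_eventuallyEq
    (f₁ := fun κ : ℝ => Real.log (vmfC d κ))
    (by filter_upwards [lt_mem_nhds hκ] with x hx using log_vmfC_eq hd hx)
  refine h.congr_deriv ?_
  simp only [besselQuotient]
  field_simp

lemma hasDerivAt_log_add_sqrt_sub_sqrt {a b : ℝ} (ha : 0 < a) (hb : 0 < b) (κ : ℝ) :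
    HasDerivAt (fun κ : ℝ => a / 2 * Real.log (a + Real.sqrt (b ^ 2 + κ ^ 2))
      - 1 / 2 * Real.sqrt (b ^ 2 + κ ^ 2)) (-(κ / (a + Real.sqrt (b ^ 2 + κ ^ 2)) / 2)) κ := by
  have hpos : 0 < b ^ 2 + κ ^ 2 := by positivity
  have hs : 0 < Real.sqrt (b ^ 2 + κ ^ 2) := Real.sqrt_pos.2 hpos
  have hd := ((hasDerivAt_pow 2 κ).const_add (b ^ 2)).sqrt hpos.ne'
  have h := (((hd.const_add a).log (by positivity)).const_mul (a / 2)).sub (hd.const_mul (1 / 2))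
  refine h.congr_deriv ?_
  norm_num
  field_simp
  ring

lemma hasDerivAt_F {d : ℕ} (hd : 2 ≤ d) (κ : ℝ) :
    HasDerivAt (F d)
      (-(κ / (((d : ℝ) - 1) / 2 + Real.sqrt ((((d : ℝ) - 1) / 2) ^ 2 + κ ^ 2)) / 2)
        + -(κ / (((d : ℝ) - 1) / 2 + Real.sqrt ((((d : ℝ) + 1) / 2) ^ 2 + κ ^ 2)) / 2)) κ := by
  have hd' : (2 : ℝ) ≤ d := by exact_mod_cast hd
  have ha : 0 < ((d : ℝ) - 1) / 2 := by linarith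
  have h := (hasDerivAt_log_add_sqrt_sub_sqrt ha ha κ).add
    (hasDerivAt_log_add_sqrt_sub_sqrt ha (by positivity : 0 < ((d : ℝ) + 1) / 2) κ)
  refine h.congr_of_eventuallyEq (.of_forall fun x => ?_)
  simp only [F, Pi.add_apply]
  ring

theorem abs_deriv_log_vmfC_sub_deriv_F_lt (d : ℕ) (hd : 2 ≤ d) (κ : ℝ) (hκ : 0 < κ) :
    |deriv (fun κ : ℝ => Real.log (vmfC d κ)) κ - deriv (F d) κ|
      < 1 / 2 * (κ / (((d : ℝ) - 1) / 2 + Real.sqrt ((((d : ℝ) - 1) / 2) ^ 2 + κ ^ 2))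
        - κ / (((d : ℝ) - 1) / 2 + Real.sqrt ((((d : ℝ) + 1) / 2) ^ 2 + κ ^ 2))) := by
  have hd' : (2 : ℝ) ≤ d := by exact_mod_cast hd
  have hv : 0 ≤ (d : ℝ) / 2 - 1 := by linarith
  have hy : 0 < κ ^ 2 / 4 := by positivity
  have hu := lt_besselQuotient hv hy
  have hlower := lt_besselQuotient_sub_sq hv hy
  have hupper := besselQuotient_sub_sq_lt hv hy
  rw [(hasDerivAt_log_vmfC hd hκ).deriv, (hasDerivAt_F hd κ).deriv]
  set u := besselQuotient ((d : ℝ) / 2 - 1) (κ ^ 2 / 4)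
  rw [show (d : ℝ) / 2 - 1 + 1 / 2 = ((d : ℝ) - 1) / 2 by ring,
    show 4 * (κ ^ 2 / 4) = κ ^ 2 by ring] at hlower hupper
  rw [show (d : ℝ) / 2 - 1 + 3 / 2 = ((d : ℝ) + 1) / 2 by ring] at hupper
  have hs₁ : Real.sqrt ((((d : ℝ) - 1) / 2) ^ 2 + κ ^ 2) < u - ((d : ℝ) - 1) / 2 :=
    (Real.sqrt_lt' (by linarith)).2 hlower
  have hs₂ : u - ((d : ℝ) - 1) / 2 < Real.sqrt ((((d : ℝ) + 1) / 2) ^ 2 + κ ^ 2) :=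
    Real.lt_sqrt_of_sq_lt hupper
  have h₀ := Real.sqrt_nonneg ((((d : ℝ) - 1) / 2) ^ 2 + κ ^ 2)
  have hh : κ / u < κ / (((d : ℝ) - 1) / 2 + Real.sqrt ((((d : ℝ) - 1) / 2) ^ 2 + κ ^ 2)) :=
    div_lt_div_of_pos_left hκ (by linarith) (by linarith)
  have hg : κ / (((d : ℝ) - 1) / 2 + Real.sqrt ((((d : ℝ) + 1) / 2) ^ 2 + κ ^ 2)) < κ / u :=
    div_lt_div_of_pos_left hκ (by linarith) (by linarith)
  rw [abs_lt]
  constructor <;> linarith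
end
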